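/- Let p ∈ (0,1), t > 0. Define f(y) = ( p(1−p) t^{1/2} / π ) · [ t( (t−y)^{1/2} − (t+y)^{1/2} ) + y( (t−y)^{1/2} + (t+y)^{1/2} ) ] / [ y (t−y)^{1/2} (t+y)^{1/2} ( (1−2p(1−p)) t + (1−2p) y ) ] for 0 < |y| < t, f(y) = ( p/π ) t^{1/2} / [ y ( p (y−t)^{1/2} + (1−p)(y+t)^{1/2} ) ] for y ≥ t, and f(y) = ( (p−1)/π ) t^{1/2} / [ y ( p (t−y)^{1/2} + (1−p)(−y−t)^{1/2} ) ] for y ≤ −t. Then f ≥ 0 almost everywhere and ∫_{−∞}^{∞} f(y) dy = 1. -/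

import Mathlib

open MeasureTheory Set

/-- The explicit density `w_t(y)` of the jump-first Lévy walk limit
`Y(t) = L_{1/2}(S_{1/2}^{−1}(t))` (Corollary 4), for stability index `α = 1/2` and
jump-direction probability `p`:
* for `y ≥ t`: `(p/π) t^{1/2} / (y (p(y−t)^{1/2} + (1−p)(y+t)^{1/2}))`;
* for `y ≤ −t`: `((p−1)/π) t^{1/2} / (y (p(t−y)^{1/2} + (1−p)(−y−t)^{1/2}))`;
* for `|y| < t`:
  `(p(1−p)t^{1/2}/π) [t((t−y)^{1/2}−(t+y)^{1/2}) + y((t−y)^{1/2}+(t+y)^{1/2})]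
    / [y (t−y)^{1/2} (t+y)^{1/2} ((1−2p(1−p))t + (1−2p)y)]`. -/
noncomputable def jumpFirstDensity (p t y : ℝ) : ℝ :=
  if t ≤ y then
    (p / Real.pi) * t ^ ((1:ℝ)/2) /
      (y * (p * (y - t) ^ ((1:ℝ)/2) + (1 - p) * (y + t) ^ ((1:ℝ)/2)))
  else if y ≤ -t then
    ((p - 1) / Real.pi) * t ^ ((1:ℝ)/2) /
      (y * (p * (t - y) ^ ((1:ℝ)/2) + (1 - p) * (-y - t) ^ ((1:ℝ)/2)))
  else
    (p * (1 - p) * t ^ ((1:ℝ)/2) / Real.pi) *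
      (t * ((t - y) ^ ((1:ℝ)/2) - (t + y) ^ ((1:ℝ)/2)) +
        y * ((t - y) ^ ((1:ℝ)/2) + (t + y) ^ ((1:ℝ)/2))) /
      (y * (t - y) ^ ((1:ℝ)/2) * (t + y) ^ ((1:ℝ)/2) *
        ((1 - 2*p*(1 - p)) * t + (1 - 2*p) * y))

section helpers

open Real

lemma jf_trig {x : ℝ} (hx : x ∈ uIcc (0:ℝ) (π/2)) : 0 ≤ sin x ∧ 0 ≤ cos x := by
  rw [uIcc_of_le (by positivity)] at hx
  exact ⟨sin_nonneg_of_nonneg_of_le_pi hx.1 (by linarith [hx.2, pi_pos]),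
    cos_nonneg_of_neg_pi_div_two_le_of_le (by linarith [hx.1, pi_pos]) hx.2⟩

lemma jf_den {p q x : ℝ} (hp : 0 < p) (hq : 0 < q) (h0 : 0 ≤ x) (h1 : x ≤ 1) :
    0 < q^2 + (p^2 - q^2) * x^2 := by
  have e : q^2 + (p^2 - q^2) * x^2 = q^2 * ((1 - x) * (1 + x)) + (p * x)^2 := by ring
  rw [e]
  rcases h0.eq_or_lt with rfl | h
  · simp; positivity
  · have : 0 ≤ 1 - x := by linarith
    positivity

lemma jf_gcont {p q : ℝ} (hp : 0 < p) (hq : 0 < q) :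
    ContinuousOn (fun x : ℝ => q^2 / (q^2 + (p^2 - q^2) * x^2)) (Icc 0 1) := by
  refine ContinuousOn.div (by fun_prop) (by fun_prop) ?_
  intro x hx
  exact (jf_den hp hq hx.1 hx.2).ne'

lemma jf_lhs {p q : ℝ} (hp : 0 < p) (hq : 0 < q) :
    ∫ x in (0:ℝ)..(π/2), q^2 * cos x / (q^2 * cos x^2 + p^2 * sin x^2) =
      ∫ x in (0:ℝ)..1, q^2 / (q^2 + (p^2 - q^2) * x^2) := by
  have := intervalIntegral.integral_comp_mul_deriv' (a := 0) (b := π/2) (f := sin) (f' := cos)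
    (g := fun x : ℝ => q^2 / (q^2 + (p^2 - q^2) * x^2))
    (fun x _ => hasDerivAt_sin x) (by fun_prop) ((jf_gcont hp hq).mono (by
      rintro _ ⟨x, hx, rfl⟩
      exact ⟨(jf_trig hx).1, sin_le_one x⟩))
  rw [sin_zero, sin_pi_div_two] at this
  rw [← this]
  apply intervalIntegral.integral_congr
  intro x hx
  simp only [Function.comp]
  have e : q^2 * cos x^2 + p^2 * sin x^2 = q^2 + (p^2 - q^2) * sin x^2 := by
    rw [cos_sq']; ring
  rw [e]; ring

lemma jf_aux {p q s c : ℝ} (hp : 0 < p) (hq : 0 < q) (hs : 0 ≤ s) (hc : 0 ≤ c) 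
    (h : s^2 + c^2 = 1) :
    q^2 / (q^2 + (p^2 - q^2) * (q * s / (q * s + p * (1 + c)))^2) *
      (p * q * (1 + c) / (q * s + p * (1 + c))^2) = (q / (q * s + p)) / 2 := by
  have hD : 0 < q * s + p * (1 + c) := by positivity
  have e : (q * s + p * (1 + c))^2 + (p^2 - q^2) * s^2 = 2 * p * (1 + c) * (q * s + p) := by
    linear_combination p^2 * h
  have e2 : q^2 + (p^2 - q^2) * (q * s / (q * s + p * (1 + c)))^2 =
      q^2 * (2 * p * (1 + c) * (q * s + p)) / (q * s + p * (1 + c))^2 := by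
    rw [← e]; field_simp
  rw [e2]
  have : 0 < q * s + p := by positivity
  field_simp

lemma jf_aux2 {p q s c : ℝ} (hp : 0 < p) (hq : 0 < q) (hs : 0 ≤ s) (hc : 0 ≤ c) 
    (h : s^2 + c^2 = 1) :
    q^2 / (q^2 + (p^2 - q^2) * (q * (1 + c) / (p * s + q * (1 + c)))^2) *
      (-(p * q * (1 + c)) / (p * s + q * (1 + c))^2) = -((q / (q * s + p)) / 2) := by
  have hD : 0 < p * s + q * (1 + c) := by positivity
  have e : (p * s + q * (1 + c))^2 + (p^2 - q^2) * (1 + c)^2 = 2 * p * (1 + c) * (q * s + p) := by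
    linear_combination p^2 * h
  have e2 : q^2 + (p^2 - q^2) * (q * (1 + c) / (p * s + q * (1 + c)))^2 =
      q^2 * (2 * p * (1 + c) * (q * s + p)) / (p * s + q * (1 + c))^2 := by
    rw [← e]; field_simp
  rw [e2]
  have : 0 < q * s + p := by positivity
  field_simp

lemma jf_rhs {p q : ℝ} (hp : 0 < p) (hq : 0 < q) :
    ∫ x in (0:ℝ)..(π/2), q / (q * sin x + p) =
      ∫ x in (0:ℝ)..1, q^2 / (q^2 + (p^2 - q^2) * x^2) := by
  have h1 := intervalIntegral.integral_comp_mul_deriv' (a := 0) (b := π/2)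
    (f := fun x => q * sin x / (q * sin x + p * (1 + cos x)))
    (f' := fun x => p * q * (1 + cos x) / (q * sin x + p * (1 + cos x))^2)
    (g := fun x : ℝ => q^2 / (q^2 + (p^2 - q^2) * x^2))
    (by
      intro x hx
      obtain ⟨hs, hc⟩ := jf_trig hx
      have hD : 0 < q * sin x + p * (1 + cos x) := by positivity
      have := ((hasDerivAt_sin x).const_mul q).div
        (((hasDerivAt_sin x).const_mul q).add (((hasDerivAt_cos x).const_add 1).const_mul p)) hD.ne'
      refine this.congr_deriv ?_
      simp only [Pi.add_apply]
      congr 1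
      linear_combination q * p * sin_sq_add_cos_sq x)
    (by
      refine ContinuousOn.div (by fun_prop) (by fun_prop) ?_
      intro x hx
      obtain ⟨hs, hc⟩ := jf_trig hx
      positivity)
    ((jf_gcont hp hq).mono (by
      rintro _ ⟨x, hx, rfl⟩
      obtain ⟨hs, hc⟩ := jf_trig hx
      refine ⟨by positivity, ?_⟩
      rw [div_le_one (by positivity)]
      have : 0 ≤ p * (1 + cos x) := by positivity
      linarith))
  have h2 := intervalIntegral.integral_comp_mul_deriv' (a := 0) (b := π/2)
    (f := fun x => q * (1 + cos x) / (p * sin x + q * (1 + cos x)))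
    (f' := fun x => -(p * q * (1 + cos x)) / (p * sin x + q * (1 + cos x))^2)
    (g := fun x : ℝ => q^2 / (q^2 + (p^2 - q^2) * x^2))
    (by
      intro x hx
      obtain ⟨hs, hc⟩ := jf_trig hx
      have hD : 0 < p * sin x + q * (1 + cos x) := by positivity
      have := (((hasDerivAt_cos x).const_add 1).const_mul q).div
        (((hasDerivAt_sin x).const_mul p).add (((hasDerivAt_cos x).const_add 1).const_mul q)) hD.ne'
      refine this.congr_deriv ?_
      simp only [Pi.add_apply]
      congr 1
      linear_combination -q * p * sin_sq_add_cos_sq x)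
    (by
      refine ContinuousOn.div (by fun_prop) (by fun_prop) ?_
      intro x hx
      obtain ⟨hs, hc⟩ := jf_trig hx
      positivity)
    ((jf_gcont hp hq).mono (by
      rintro _ ⟨x, hx, rfl⟩
      obtain ⟨hs, hc⟩ := jf_trig hx
      refine ⟨by positivity, ?_⟩
      rw [div_le_one (by positivity)]
      have : 0 ≤ p * sin x := by positivity
      linarith))
  rw [intervalIntegral.integral_congr (g := fun x => (q / (q * sin x + p)) / 2) (by
    intro x hx
    obtain ⟨hs, hc⟩ := jf_trig hx
    exact jf_aux hp hq hs hc (sin_sq_add_cos_sq x))] at h1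
  rw [intervalIntegral.integral_congr (g := fun x => -((q / (q * sin x + p)) / 2)) (by
    intro x hx
    obtain ⟨hs, hc⟩ := jf_trig hx
    exact jf_aux2 hp hq hs hc (sin_sq_add_cos_sq x))] at h2
  simp only [sin_zero, cos_zero, sin_pi_div_two, cos_pi_div_two, 
    intervalIntegral.integral_neg, intervalIntegral.integral_div] at h1 h2
  have a1 : q * 0 / (q * 0 + p * (1 + 1)) = 0 := by simp
  have a2 : q * (1 + 1) / (p * 0 + q * (1 + 1)) = 1 := by field_simp; ring
  have a3 : q * 1 / (q * 1 + p * (1 + 0)) = q / (p + q) := by ring_nf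
  have a4 : q * (1 + 0) / (p * 1 + q * (1 + 0)) = q / (p + q) := by ring_nf
  rw [a1, a3] at h1
  rw [a2, a4] at h2
  have b0 : 0 ≤ q / (p + q) := by positivity
  have b1 : q / (p + q) ≤ 1 := by rw [div_le_one (by positivity)]; linarith
  have i1 : IntervalIntegrable (fun x : ℝ => q^2 / (q^2 + (p^2 - q^2) * x^2)) volume 0 (q / (p+q)) :=
    ((jf_gcont hp hq).mono (by rw [uIcc_of_le b0]; exact Icc_subset_Icc le_rfl b1)).intervalIntegrable
  have i2 : IntervalIntegrable (fun x : ℝ => q^2 / (q^2 + (p^2 - q^2) * x^2)) volume (q / (p+q)) 1 :=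
    ((jf_gcont hp hq).mono (by rw [uIcc_of_le b1]; exact Icc_subset_Icc b0 le_rfl)).intervalIntegrable
  rw [← intervalIntegral.integral_add_adjacent_intervals i1 i2,
    intervalIntegral.integral_symm 1 (q / (p+q)), ← h1, ← h2]
  ring

/-- key identity -/
lemma jf_key {p q : ℝ} (hp : 0 < p) (hq : 0 < q) :
    ∫ x in (0:ℝ)..(π/2), q^2 * cos x / (q^2 * cos x^2 + p^2 * sin x^2) =
    ∫ x in (0:ℝ)..(π/2), q / (q * sin x + p) := by rw [jf_lhs hp hq, jf_rhs hp hq]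

lemma jf_key' {p q : ℝ} (hp : 0 < p) (hq : 0 < q) :
    ∫ x in (0:ℝ)..(π/2), p^2 * sin x / (q^2 * cos x^2 + p^2 * sin x^2) =
    ∫ x in (0:ℝ)..(π/2), p / (p * sin x + q) := by
  rw [← jf_key hq hp]
  have := intervalIntegral.integral_comp_sub_left (a := 0) (b := π/2)
    (fun x => p^2 * cos x / (p^2 * cos x^2 + q^2 * sin x^2)) (π/2)
  simp only [cos_pi_div_two_sub, sin_pi_div_two_sub, sub_self, sub_zero] at this
  rw [← this]
  congr 1; ext x; rw [add_comm]

lemma jf_g2cont : ContinuousOn (fun x : ℝ => 1 / (2 - x^2)) (Icc (-1) 1) := by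
  refine ContinuousOn.div (by fun_prop) (by fun_prop) ?_
  intro x hx
  have := hx.1; have := hx.2
  nlinarith

lemma jf_log : ∫ x in (0:ℝ)..(π/2), 1 / (sin x + cos x) =
    ∫ x in (0:ℝ)..(π/2), 2 * sin x / (1 + sin x^2) := by
  have h1 := intervalIntegral.integral_comp_mul_deriv' (a := 0) (b := π/2)
    (f := fun x => sin x - cos x)
    (f' := fun x => cos x + sin x)
    (g := fun x : ℝ => 1 / (2 - x^2))
    (by
      intro x hx
      have := (hasDerivAt_sin x).sub (hasDerivAt_cos x)
      refine this.congr_deriv ?_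
      ring) (by fun_prop) (jf_g2cont.mono (by
      rintro _ ⟨x, hx, rfl⟩
      obtain ⟨hs, hc⟩ := jf_trig hx
      have := sin_le_one x
      have := cos_le_one x
      constructor <;> simp only <;> linarith))
  have h2 := intervalIntegral.integral_comp_mul_deriv' (a := 0) (b := π/2)
    (f := cos) (f' := fun x => - sin x)
    (g := fun x : ℝ => 1 / (2 - x^2))
    (fun x _ => hasDerivAt_cos x) (by fun_prop) (jf_g2cont.mono (by
      rintro _ ⟨x, hx, rfl⟩
      exact ⟨neg_one_le_cos x, cos_le_one x⟩))
  have i1 : IntervalIntegrable (fun x : ℝ => 1 / (2 - x^2)) volume (-1) 0 :=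
    (jf_g2cont.mono (by rw [uIcc_of_le (by norm_num)]; exact Icc_subset_Icc le_rfl (by norm_num))).intervalIntegrable
  have i2 : IntervalIntegrable (fun x : ℝ => 1 / (2 - x^2)) volume 0 1 :=
    (jf_g2cont.mono (by rw [uIcc_of_le (by norm_num)]; exact Icc_subset_Icc (by norm_num) le_rfl)).intervalIntegrable
  have h3 := intervalIntegral.integral_comp_neg (a := 0) (b := 1) (fun x : ℝ => 1 / (2 - x^2))
  simp only [neg_sq, neg_zero] at h3
  simp only [sin_zero, cos_zero, sin_pi_div_two, cos_pi_div_two, zero_sub, sub_zero] at h1 h2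
  rw [← intervalIntegral.integral_add_adjacent_intervals i1 i2, ← h3] at h1
  rw [intervalIntegral.integral_symm 0 1] at h2
  have e1 : ∫ x in (0:ℝ)..(π/2), 1 / (sin x + cos x) = ∫ x in (0:ℝ)..(π/2),
    ((fun x : ℝ => 1 / (2 - x^2)) ∘ fun x => sin x - cos x) x * (cos x + sin x) := by
    apply intervalIntegral.integral_congr
    intro x hx
    obtain ⟨hs, hc⟩ := jf_trig hx
    have hpos : 0 < sin x + cos x := by
      nlinarith [sin_sq_add_cos_sq x, sin_le_one x, cos_le_one x]
    have e : 2 - (sin x - cos x)^2 = (sin x + cos x)^2 := by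
      linear_combination -2 * sin_sq_add_cos_sq x
    simp only [Function.comp, e]
    field_simp
    ring
  have e2 : ∫ x in (0:ℝ)..(π/2), 2 * sin x / (1 + sin x^2) = ∫ x in (0:ℝ)..(π/2), 
    (-2) * (((fun x : ℝ => 1 / (2 - x^2)) ∘ cos) x * (-sin x)) := by
    apply intervalIntegral.integral_congr
    intro x hx
    simp only [Function.comp, cos_sq']
    rw [show (2:ℝ) - (1 - sin x^2) = 1 + sin x^2 by ring]
    ring
  rw [e1, e2, intervalIntegral.integral_const_mul, h1, h2]
  ring

lemma jf_B : ∫ x in (0:ℝ)..(π/2), 1 / (1 + sin x^2) = π / (2 * √2) := by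
  have h2 : (√2)^2 = 2 := sq_sqrt (by norm_num)
  have hr : 0 < √2 := by positivity
  have hD : ∀ x : ℝ, 0 < cos x^2 + √2 * sin x^2 := by
    intro x
    have : 1 ≤ √2 := by rw [one_le_sqrt]; norm_num
    nlinarith [sin_sq_add_cos_sq x, sq_nonneg (sin x)]
  rw [intervalIntegral.integral_eq_sub_of_hasDerivAt (f := fun x => 
    (x + arctan ((√2 - 1) * (sin x * cos x) / (cos x^2 + √2 * sin x^2))) / √2)]
  · simp; field_simp
  · intro x _
    have hd := ((((hasDerivAt_sin x).mul (hasDerivAt_cos x)).const_mul (√2 - 1)).div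
      (((hasDerivAt_cos x).pow 2).add (((hasDerivAt_sin x).pow 2).const_mul √2)) (hD x).ne').arctan
    have := ((hasDerivAt_id x).add hd).div_const √2
    refine this.congr_deriv ?_
    have := hD x
    simp only [Pi.add_apply, Pi.mul_apply, Pi.pow_apply, Pi.div_apply]
    generalize √2 = r at *
    have h := sin_sq_add_cos_sq x
    generalize sin x = s at *
    generalize cos x = c at *
    have e1 : 1 + ((r - 1) * (s * c) / (c^2 + r * s^2))^2 =
      (1 + s^2) / (c^2 + r * s^2)^2 := by
      field_simp
      have hc : c^2 = 1 - s^2 := by linarith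
      have hc4 : c^4 = (1 - s^2)^2 := by rw [← hc]; ring
      ring_nf
      simp only [hc4, hc, h2]
      ring
    rw [e1]
    have h1s : 0 < 1 + s^2 := by positivity
    trans (1 + 1 / ((1 + s^2) / (c^2 + r * s^2)^2) * ((r - 1 - s^2) / (c^2 + r * s^2)^2)) / r
    · congr 4
      have hc : c^2 = 1 - s^2 := by linarith
      have hc4 : c^4 = (1 - s^2)^2 := by rw [← hc]; ring
      push_cast
      ring_nf
      simp only [hc4, hc, h2]
      ring_nf
    · generalize c^2 + r * s^2 = D at *
      field_simp
      ring
  · apply Continuous.intervalIntegrable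
    refine Continuous.div (by fun_prop) (by fun_prop) ?_
    intro x; positivity

lemma jf_sc {x : ℝ} (hx : x ∈ uIcc (0:ℝ) (π/2)) : 0 < sin x + cos x := by
  obtain ⟨hs, hc⟩ := jf_trig hx
  nlinarith [sin_sq_add_cos_sq x, sin_le_one x, cos_le_one x]

lemma jf_E {p q x : ℝ} (hp : 0 < p) (hq : 0 < q) (hx : x ∈ uIcc (0:ℝ) (π/2)) :
    0 < q^2 * cos x^2 + p^2 * sin x^2 := by
  obtain ⟨hs, hc⟩ := jf_trig hx
  have := jf_sc hx
  rcases hs.eq_or_lt with h | h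
  · rw [← h] at this ⊢
    have : 0 < cos x := by linarith
    positivity
  · positivity

lemma jf_c1 (p q : ℝ) (hp : 0 < p) (hq : 0 < q) : ContinuousOn 
    (fun x => p * sin x / ((1 + sin x^2) * (p * sin x + q))) (uIcc 0 (π/2)) := by
  refine ContinuousOn.div (by fun_prop) (by fun_prop) ?_
  intro x hx
  obtain ⟨hs, hc⟩ := jf_trig hx
  positivity

lemma jf_c3 (p q : ℝ) (hp : 0 < p) (hq : 0 < q) : ContinuousOn 
    (fun x => p * q * (sin x * cos x) / 
      ((sin x + cos x) * (q^2 * cos x^2 + p^2 * sin x^2))) (uIcc 0 (π/2)) := by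
  refine ContinuousOn.div (by fun_prop) (by fun_prop) ?_
  intro x hx
  have := jf_sc hx
  have := jf_E hp hq hx
  positivity

lemma jf_pt {p q s c : ℝ} (hp : 0 < p) (hq : 0 < q) (hs : 0 ≤ s) (hsc : 0 < s + c)
    (hE : 0 < q^2 * c^2 + p^2 * s^2) :
    p * s / ((1 + s^2) * (p * s + q)) + q * s / ((1 + s^2) * (q * s + p)) +
      p * q * (s * c) / ((s + c) * (q^2 * c^2 + p^2 * s^2)) =
    1 / (1 + s^2) + p * q / (p^2 + q^2) * (2 * s / (1 + s^2) - p / (p * s + q) - q / (q * s + p)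
      - 1 / (s + c) + p^2 * s / (q^2 * c^2 + p^2 * s^2) + q^2 * c / (q^2 * c^2 + p^2 * s^2)) := by
  have e1 : p * s / ((1 + s^2) * (p * s + q)) = 
    p / (p^2 + q^2) * ((q * s + p) / (1 + s^2) - p * q / (p * s + q)) := by
    field_simp; ring
  have e2 : q * s / ((1 + s^2) * (q * s + p)) = 
    q / (p^2 + q^2) * ((p * s + q) / (1 + s^2) - p * q / (q * s + p)) := by
    field_simp; ring
  have e3 : p * q * (s * c) / ((s + c) * (q^2 * c^2 + p^2 * s^2)) =
    p * q / (p^2 + q^2) * (- (1 / (s + c)) + (p^2 * s + q^2 * c) / (q^2 * c^2 + p^2 * s^2)) := by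
    have hE' := hE.ne'
    have hsc' := hsc.ne'
    generalize hE0 : q^2 * c^2 + p^2 * s^2 = E at *
    field_simp
    rw [← hE0]; ring
  have e4 : 1 / (1 + s^2) = 1 / (p^2 + q^2) * ((p^2 + q^2) / (1 + s^2)) := by
    field_simp
  rw [e1, e2, e3, e4]
  ring

lemma jf_total {p q : ℝ} (hp : 0 < p) (hq : 0 < q) :
    (∫ x in (0:ℝ)..(π/2), p * sin x / ((1 + sin x^2) * (p * sin x + q))) +
    (∫ x in (0:ℝ)..(π/2), q * sin x / ((1 + sin x^2) * (q * sin x + p))) +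
    (∫ x in (0:ℝ)..(π/2), p * q * (sin x * cos x) / 
      ((sin x + cos x) * (q^2 * cos x^2 + p^2 * sin x^2))) = π / (2 * √2) := by
  have i1 := (jf_c1 p q hp hq).intervalIntegrable (μ := volume)
  have i2 := (jf_c1 q p hq hp).intervalIntegrable (μ := volume)
  have i3 := (jf_c3 p q hp hq).intervalIntegrable (μ := volume)
  rw [← intervalIntegral.integral_add i1 i2, ← intervalIntegral.integral_add (i1.add i2) i3]
  rw [intervalIntegral.integral_congr (fun x hx => jf_pt hp hq (jf_trig hx).1 (jf_sc hx)
    (jf_E hp hq hx))]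
  have k0 : IntervalIntegrable (fun x => 1 / (1 + sin x^2)) volume 0 (π/2) := by
    apply Continuous.intervalIntegrable
    refine Continuous.div (by fun_prop) (by fun_prop) ?_
    intro x; positivity
  have k1 : IntervalIntegrable (fun x => 2 * sin x / (1 + sin x^2)) volume 0 (π/2) := by
    apply Continuous.intervalIntegrable
    refine Continuous.div (by fun_prop) (by fun_prop) ?_
    intro x; positivity
  have k2 : ∀ p q : ℝ, 0 < p → 0 < q → 
      IntervalIntegrable (fun x => p / (p * sin x + q)) volume 0 (π/2) := by
    intro p q hp hq
    apply ContinuousOn.intervalIntegrable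
    refine ContinuousOn.div (by fun_prop) (by fun_prop) ?_
    intro x hx
    obtain ⟨hs, hc⟩ := jf_trig hx
    positivity
  have k3 : IntervalIntegrable (fun x => 1 / (sin x + cos x)) volume 0 (π/2) := by
    apply ContinuousOn.intervalIntegrable
    refine ContinuousOn.div (by fun_prop) (by fun_prop) ?_
    intro x hx
    exact (jf_sc hx).ne'
  have k4 : IntervalIntegrable (fun x => p^2 * sin x / (q^2 * cos x^2 + p^2 * sin x^2)) volume 0 (π/2) := by
    apply ContinuousOn.intervalIntegrable
    refine ContinuousOn.div (by fun_prop) (by fun_prop) ?_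
    intro x hx
    exact (jf_E hp hq hx).ne'
  have k5 : IntervalIntegrable (fun x => q^2 * cos x / (q^2 * cos x^2 + p^2 * sin x^2)) volume 0 (π/2) := by
    apply ContinuousOn.intervalIntegrable
    refine ContinuousOn.div (by fun_prop) (by fun_prop) ?_
    intro x hx
    exact (jf_E hp hq hx).ne'
  have m1 := k1.sub (k2 p q hp hq)
  have m2 := m1.sub (k2 q p hq hp)
  have m3 := m2.sub k3
  have m4 := m3.add k4
  have m5 := m4.add k5
  have := intervalIntegral.integral_add k0 (m5.const_mul (p * q / (p^2 + q^2)))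
  refine this.trans ?_
  rw [intervalIntegral.integral_const_mul, jf_B]
  have z : (∫ x in (0:ℝ)..(π/2), (2 * sin x / (1 + sin x^2) - p / (p * sin x + q) - 
      q / (q * sin x + p)
      - 1 / (sin x + cos x) + p^2 * sin x / (q^2 * cos x^2 + p^2 * sin x^2) + 
      q^2 * cos x / (q^2 * cos x^2 + p^2 * sin x^2))) = 0 := by
    refine (intervalIntegral.integral_add m4 k5).trans ?_
    have a4 := intervalIntegral.integral_add m3 k4
    have a3 := intervalIntegral.integral_sub m2 k3
    have a2 := intervalIntegral.integral_sub m1 (k2 q p hq hp)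
    have a1 := intervalIntegral.integral_sub k1 (k2 p q hp hq)
    rw [jf_key hp hq]
    refine (congrArg (· + _) a4).trans ?_
    rw [jf_key' hp hq]
    refine (congrArg (· + _ + _) a3).trans ?_
    refine (congrArg (· - _ + _ + _) a2).trans ?_
    refine (congrArg (· - _ - _ + _ + _) a1).trans ?_
    rw [jf_log]
    ring
  refine (congrArg (fun z => _ + _ * z) z).trans ?_
  simp

lemma jf_cov {φ φ' F h : ℝ → ℝ} 
    (hd : ∀ x ∈ Ioo 0 (π/2), HasDerivAt φ (φ' x) x) (hi : InjOn φ (Ioo 0 (π/2)))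
    (he : ∀ x ∈ Ioo 0 (π/2), |φ' x| * F (φ x) = h x) (hc : ContinuousOn h (uIcc 0 (π/2))) :
    IntegrableOn F (φ '' (Ioo 0 (π/2))) ∧
      ∫ y in φ '' (Ioo 0 (π/2)), F y = ∫ x in (0:ℝ)..(π/2), h x := by
  have hd' := fun x hx => (hd x hx).hasDerivWithinAt (s := Ioo 0 (π/2))
  have hpi : 0 ≤ π/2 := by positivity
  constructor
  · rw [integrableOn_image_iff_integrableOn_abs_deriv_smul measurableSet_Ioo hd' hi]
    rw [uIcc_of_le hpi] at hc
    refine IntegrableOn.congr_fun (f := h) ?_ (fun x hx => (he x hx).symm) measurableSet_Ioo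
    exact hc.integrableOn_Icc.mono_set Ioo_subset_Icc_self
  · rw [integral_image_eq_integral_abs_deriv_smul measurableSet_Ioo hd' hi,
      intervalIntegral.integral_of_le hpi, integral_Ioc_eq_integral_Ioo]
    exact setIntegral_congr_fun measurableSet_Ioo he
lemma jf_right {p t : ℝ} (hp : 0 < p) (hp1 : p < 1) (ht : 0 < t) {F : ℝ → ℝ}
    (hF : ∀ y, t < y → F y = (p / π) * √t / (y * (p * √(y - t) + (1 - p) * √(y + t)))) :
    IntegrableOn F (Ioi t) ∧ ∫ y in Ioi t, F y =
      2 * √2 / π * ∫ x in (0:ℝ)..(π/2), p * sin x / ((1 + sin x^2) * (p * sin x + (1 - p))) := by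
  have hq : 0 < 1 - p := by linarith
  have hcs : ∀ x ∈ Ioo 0 (π/2), 0 < sin x ∧ 0 < cos x := fun x hx =>
    ⟨sin_pos_of_pos_of_lt_pi hx.1 (by linarith [hx.2, pi_pos]),
     cos_pos_of_mem_Ioo ⟨by linarith [hx.1, pi_pos], hx.2⟩⟩
  have him : (fun x => t * (2 / cos x^2 - 1)) '' (Ioo 0 (π/2)) = Ioi t := by
    ext y
    constructor
    · rintro ⟨x, hx, rfl⟩
      obtain ⟨hs, hc⟩ := hcs x hx
      have : 1 < 1 / cos x^2 := by
        rw [lt_div_iff₀ (by positivity)]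
        nlinarith [sin_sq_add_cos_sq x]
      have e : t * (2 / cos x^2 - 1) = t + 2 * t * (1 / cos x^2 - 1) := by ring
      simp only [mem_Ioi, e]
      have : 0 < 2 * t * (1 / cos x^2 - 1) := by
        have : 0 < 1 / cos x^2 - 1 := by linarith
        positivity
      linarith
    · intro hy
      have hy : t < y := hy
      have h0 : 0 < 2 * t / (y + t) := by
        have : 0 < y + t := by linarith
        positivity
      have h1 : 2 * t / (y + t) < 1 := by
        rw [div_lt_one (by linarith)]; linarith
      have a0 : 0 < √(2 * t / (y + t)) := sqrt_pos.2 h0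
      have a1 : √(2 * t / (y + t)) < 1 := by
        rw [sqrt_lt' one_pos]; simpa using h1
      refine ⟨arccos √(2 * t / (y + t)), ⟨arccos_pos.2 a1, arccos_lt_pi_div_two.2 a0⟩, ?_⟩
      simp only
      rw [cos_arccos (by linarith) a1.le, sq_sqrt h0.le]
      field_simp
      ring
  have := jf_cov (φ := fun x => t * (2 / cos x^2 - 1)) (φ' := fun x => 4 * t * sin x / cos x^3)
    (F := F) (h := fun x => 2 * √2 / π * (p * sin x / ((1 + sin x^2) * (p * sin x + (1 - p)))))
    (by
      intro x hx
      obtain ⟨hs, hc⟩ := hcs x hx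
      have := ((((hasDerivAt_const x (2:ℝ)).div ((hasDerivAt_cos x).pow 2) 
        (by simp only [Pi.pow_apply]; positivity)).sub_const 1).const_mul t)
      refine this.congr_deriv ?_
      simp only [Pi.pow_apply]
      field_simp
      norm_num
      try ring)
    (by
      intro x hx y hy hxy
      obtain ⟨hs, hc⟩ := hcs x hx
      obtain ⟨hs', hc'⟩ := hcs y hy
      have h1 := mul_left_cancel₀ ht.ne' hxy
      have h2 : cos x^2 = cos y^2 := by
        have : 2 / cos x^2 = 2 / cos y^2 := by linarith
        field_simp at this
        linarith
      have h3 : cos x = cos y := by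
        rwa [sq_eq_sq₀ hc.le hc'.le] at h2
      exact injOn_cos ⟨hx.1.le, by linarith [hx.2, pi_pos]⟩ ⟨hy.1.le, by linarith [hy.2, pi_pos]⟩ h3)
    (by
      intro x hx
      obtain ⟨hs, hc⟩ := hcs x hx
      have hy : t < t * (2 / cos x^2 - 1) := by
        have : t * (2 / cos x^2 - 1) ∈ Ioi t := by rw [← him]; exact ⟨x, hx, rfl⟩
        exact this
      rw [hF _ hy, abs_of_pos (by positivity)]
      have hc2 : cos x^2 = 1 - sin x^2 := cos_sq' x
      have e1 : t * (2 / cos x^2 - 1) - t = (√2 * √t * sin x / cos x)^2 := by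
        rw [div_pow, mul_pow, mul_pow, sq_sqrt ht.le, sq_sqrt (by norm_num)]
        field_simp
        rw [hc2]; ring
      have e2 : t * (2 / cos x^2 - 1) + t = (√2 * √t / cos x)^2 := by
        rw [div_pow, mul_pow, sq_sqrt ht.le, sq_sqrt (by norm_num)]
        field_simp
        ring
      have e3 : t * (2 / cos x^2 - 1) = t * (1 + sin x^2) / cos x^2 := by
        field_simp; rw [hc2]; ring
      rw [e1, e2, sqrt_sq (by positivity), sqrt_sq (by positivity), e3]
      have r2 : √2^2 = 2 := sq_sqrt (by norm_num)
      have rt : 0 < √t := sqrt_pos.2 ht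
      have : 0 < √2 := by positivity
      field_simp
      rw [r2]; ring)
    (by
      exact (jf_c1 p (1-p) hp hq).const_mul _ )
  rw [him, intervalIntegral.integral_const_mul] at this
  exact this

lemma jf_mid {p t : ℝ} (hp : 0 < p) (hp1 : p < 1) (ht : 0 < t) {F : ℝ → ℝ}
    (hF : ∀ y, -t < y → y < t → F y = (2 * p * (1 - p) / π) * √t /
      ((√(t + y) + √(t - y)) * ((1 - p)^2 * (t + y) + p^2 * (t - y)))) :
    IntegrableOn F (Ioo (-t) t) ∧ ∫ y in Ioo (-t) t, F y =
      2 * √2 / π * ∫ x in (0:ℝ)..(π/2), p * (1 - p) * (sin x * cos x) / 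
      ((sin x + cos x) * ((1 - p)^2 * cos x^2 + p^2 * sin x^2)) := by
  have hq : 0 < 1 - p := by linarith
  have hcs : ∀ x ∈ Ioo 0 (π/2), 0 < sin x ∧ 0 < cos x := fun x hx =>
    ⟨sin_pos_of_pos_of_lt_pi hx.1 (by linarith [hx.2, pi_pos]),
     cos_pos_of_mem_Ioo ⟨by linarith [hx.1, pi_pos], hx.2⟩⟩
  have him : (fun x => t * cos (2 * x)) '' (Ioo 0 (π/2)) = Ioo (-t) t := by
    ext y
    constructor
    · rintro ⟨x, hx, rfl⟩
      obtain ⟨hs, hc⟩ := hcs x hx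
      have h1 := cos_two_mul x
      have h2 := sin_sq_add_cos_sq x
      have a : 0 < cos x^2 := by positivity
      have b : 0 < sin x^2 := by positivity
      constructor <;> simp only <;> nlinarith
    · rintro ⟨h1, h2⟩
      have a1 : -1 < y / t := by rw [lt_div_iff₀ ht]; linarith
      have a2 : y / t < 1 := by rw [div_lt_iff₀ ht]; linarith
      refine ⟨arccos (y / t) / 2, ⟨by have := arccos_pos.2 a2; positivity, ?_⟩, ?_⟩
      · have : arccos (y / t) < π := by
          refine lt_of_le_of_ne (arccos_le_pi _) ?_
          intro h
          rw [arccos_eq_pi] at h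
          linarith
        linarith
      · simp only
        rw [mul_div_cancel₀ _ (by norm_num), cos_arccos a1.le a2.le]
        field_simp
  have := jf_cov (φ := fun x => t * cos (2 * x)) (φ' := fun x => - (4 * t * sin x * cos x))
    (F := F) (h := fun x => 2 * √2 / π * (p * (1 - p) * (sin x * cos x) / 
      ((sin x + cos x) * ((1 - p)^2 * cos x^2 + p^2 * sin x^2))))
    (by
      intro x hx
      have := (((hasDerivAt_id x).const_mul 2).cos).const_mul t
      refine this.congr_deriv ?_
      simp only [id, sin_two_mul]
      ring)
    (by
      intro x hx y hy hxy
      have h1 := mul_left_cancel₀ ht.ne' hxy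
      have := injOn_cos ⟨by linarith [hx.1], by linarith [hx.2, pi_pos]⟩ 
        ⟨by linarith [hy.1], by linarith [hy.2, pi_pos]⟩ h1
      linarith)
    (by
      intro x hx
      obtain ⟨hs, hc⟩ := hcs x hx
      have hy : t * cos (2 * x) ∈ Ioo (-t) t := by rw [← him]; exact ⟨x, hx, rfl⟩
      rw [hF _ hy.1 hy.2, abs_neg, abs_of_pos (by positivity)]
      have r2 : √2^2 = 2 := sq_sqrt (by norm_num)
      have rt : 0 < √t := sqrt_pos.2 ht
      have rtt : √t^2 = t := sq_sqrt ht.le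
      have e1 : t + t * cos (2 * x) = (√2 * √t * cos x)^2 := by
        rw [mul_pow, mul_pow, r2, rtt, cos_two_mul]; ring
      have e2 : t - t * cos (2 * x) = (√2 * √t * sin x)^2 := by
        rw [mul_pow, mul_pow, r2, rtt, cos_two_mul, cos_sq']; ring
      rw [e1, e2, sqrt_sq (by positivity), sqrt_sq (by positivity)]
      have : 0 < √2 := by positivity
      have e3 : (√2 * √t * cos x + √2 * √t * sin x) * ((1 - p) ^ 2 * (√2 * √t * cos x) ^ 2 + p ^ 2 * (√2 * √t * sin x) ^ 2)
        = (√2 * √t) * (2 * t) * ((sin x + cos x) * ((1 - p)^2 * cos x^2 + p^2 * sin x^2)) := by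
        rw [mul_pow, mul_pow, mul_pow _ (sin x), mul_pow, r2, rtt]; ring
      rw [e3]
      have hE : 0 < (sin x + cos x) * ((1 - p)^2 * cos x^2 + p^2 * sin x^2) := by positivity
      generalize (sin x + cos x) * ((1 - p)^2 * cos x^2 + p^2 * sin x^2) = E at *
      field_simp
      rw [r2]; ring)
    (by
      exact (jf_c3 p (1-p) hp hq).const_mul _ )
  rw [him, intervalIntegral.integral_const_mul] at this
  exact this

lemma jf_dr {p t y : ℝ} (hy : t < y) : jumpFirstDensity p t y =
    (p / π) * √t / (y * (p * √(y - t) + (1 - p) * √(y + t))) := by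
  rw [jumpFirstDensity, if_pos hy.le]
  simp only [← sqrt_eq_rpow]

lemma jf_dl {p t y : ℝ} (ht : 0 < t) (hy : t < y) : jumpFirstDensity p t (-y) =
    ((1 - p) / π) * √t / (y * ((1 - p) * √(y - t) + (1 - (1 - p)) * √(y + t))) := by
  rw [jumpFirstDensity, if_neg (by linarith), if_pos (by linarith)]
  simp only [← sqrt_eq_rpow]
  rw [show t - -y = y + t by ring, show - -y - t = y - t by ring,
    show (p - 1) / π * √t = - ((1 - p) / π * √t) by ring, neg_mul, neg_div_neg_eq]
  congr 2
  ring

lemma jf_dm {p t y : ℝ} (h1 : -t < y) (h2 : y < t) (h0 : y ≠ 0) :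
    jumpFirstDensity p t y = (2 * p * (1 - p) / π) * √t /
      ((√(t + y) + √(t - y)) * ((1 - p)^2 * (t + y) + p^2 * (t - y))) := by
  rw [jumpFirstDensity, if_neg (by linarith), if_neg (by linarith)]
  simp only [← sqrt_eq_rpow]
  have ha : 0 < √(t + y) := sqrt_pos.2 (by linarith)
  have hb : 0 < √(t - y) := sqrt_pos.2 (by linarith)
  have ea : √(t + y)^2 = t + y := sq_sqrt (by linarith)
  have eb : √(t - y)^2 = t - y := sq_sqrt (by linarith)
  have eD : (1 - 2*p*(1 - p)) * t + (1 - 2*p) * y = (1 - p)^2 * (t + y) + p^2 * (t - y) := by ring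
  have hD : 0 < (1 - p)^2 * (t + y) + p^2 * (t - y) := by
    have : 0 < t + y := by linarith
    have : 0 < t - y := by linarith
    by_cases hp : p = 0
    · subst hp; simpa
    · have : 0 < p^2 := by positivity
      positivity
  rw [eD]
  generalize (1 - p)^2 * (t + y) + p^2 * (t - y) = D at *
  generalize √(t + y) = a at *
  generalize √(t - y) = b at *
  have e : t * (b - a) + y * (b + a) = a * b * (a - b) := by
    linear_combination -b * ea + a * eb
  have e' : (a - b) * (a + b) = 2 * y := by linear_combination ea - eb
  rw [e]
  field_simp
  linear_combination p * (1-p) * √t * e'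

end helpers

/-- The piecewise expression of Corollary 4 is (a.e.) nonnegative and integrates to one
over the real line, i.e. it is a probability density. -/
theorem jump_first_density_is_probability_density (p t : ℝ)
    (hp : p ∈ Ioo (0:ℝ) 1) (ht : 0 < t) :
    (∀ᵐ y : ℝ, 0 ≤ jumpFirstDensity p t y) ∧
    (∫ y : ℝ, jumpFirstDensity p t y) = 1 := by
  obtain ⟨hp0, hp1⟩ := hp
  have hq : 0 < 1 - p := by linarith
  have hne : ∀ a : ℝ, ∀ᵐ y : ℝ, y ≠ a := fun a => by
    simp [ae_iff]
  constructor
  · filter_upwards [hne 0, hne t, hne (-t)] with y h0 h1 h2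
    rcases lt_or_gt_of_ne h1 with h | h
    · rcases lt_or_gt_of_ne h2 with h' | h'
      · have := jf_dl (p := p) ht (y := -y) (by linarith)
        rw [neg_neg] at this
        rw [this]
        have : 0 < -y := by linarith
        have : 0 ≤ 1 - (1 - p) := by linarith
        positivity
      · rw [jf_dm h' h h0]
        have : 0 < t + y := by linarith
        have : 0 < t - y := by linarith
        positivity
    · rw [jf_dr h]
      have : 0 < y := by linarith
      positivity
  · obtain ⟨iR, vR⟩ := jf_right hp0 hp1 ht (F := jumpFirstDensity p t) (fun y hy => jf_dr hy)
    obtain ⟨iL, vL⟩ := jf_right hq (by linarith) ht (F := fun y => jumpFirstDensity p t (-y))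
      (fun y hy => jf_dl ht hy)
    obtain ⟨iM, vM⟩ := jf_mid hp0 hp1 ht (fun y _ _ => rfl)
    have hM : (fun y => (2 * p * (1 - p) / Real.pi) * √t /
      ((√(t + y) + √(t - y)) * ((1 - p)^2 * (t + y) + p^2 * (t - y)))) =ᵐ[volume.restrict (Ioo (-t) t)]
        jumpFirstDensity p t := by
      rw [Filter.EventuallyEq, ae_restrict_iff' measurableSet_Ioo]
      filter_upwards [hne 0] with y h0 hy
      exact (jf_dm hy.1 hy.2 h0).symm
    rw [integral_congr_ae hM] at vM
    have iM' : IntegrableOn (jumpFirstDensity p t) (Ioo (-t) t) := Integrable.congr iM hM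
    rw [integral_comp_neg_Ioi] at vL
    have iL' : IntegrableOn (jumpFirstDensity p t) (Iic (-t)) := by
      rw [integrableOn_Iic_iff_integrableOn_Iio]
      have := iL.comp_neg
      simpa using this
    have iR' : IntegrableOn (jumpFirstDensity p t) (Ici t) := by
      rwa [integrableOn_Ici_iff_integrableOn_Ioi]
    rw [← integral_Ici_eq_integral_Ioi] at vR
    have u1 : Iic (-t) ∪ Ioo (-t) t = Iio t := Iic_union_Ioo_eq_Iio (by linarith)
    have s1 := setIntegral_union (μ := volume) (f := jumpFirstDensity p t) 
      (s := Iic (-t)) (t := Ioo (-t) t) 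
      (by rw [Set.disjoint_left]; intro a ha hb; exact absurd hb.1 (not_lt.2 ha))
      measurableSet_Ioo iL' iM'
    have s2 := setIntegral_union (μ := volume) (f := jumpFirstDensity p t) 
      (s := Iio t) (t := Ici t) 
      (by rw [Set.disjoint_left]; intro a ha hb; exact absurd (mem_Iio.1 ha) (not_lt.2 (mem_Ici.1 hb)))
      measurableSet_Ici (by rw [← u1]; exact iL'.union iM') iR'
    rw [u1] at s1
    rw [Iio_union_Ici, setIntegral_univ, s1, vL, vM, vR] at s2
    rw [s2]
    have T := jf_total hp0 hq
    have ee : 1 - (1 - p) = p := by ring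
    rw [ee]
    have : 2 * √2 / Real.pi * (Real.pi / (2 * √2)) = 1 := by
      have := Real.pi_pos
      have : 0 < √(2:ℝ) := by positivity
      field_simp
    refine Eq.trans ?_ this
    rw [← T, ← mul_add, ← mul_add]
    congr 1
    abel
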